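/- arXiv:2209.01481 — 3 statements merged into one kernel-verified Lean document; each statement's English description precedes it below -/
import Mathlib

section
/- Let p be a prime with p > 3, and let M ⊆ ℤ × ℤ be the additive submonoid generated by (1,0), (0,1), (2,−1), (−1,2). For every λ ∈ ℤ × ℤ, the set N(λ) = { μ ∈ ℤ × ℤ : λ − p·μ ∈ M and (3(p−1), 3(p−1)) − (λ − p·μ) ∈ M } is finite and has at most 27 elements. If moreover p > 9, then N(λ) has at least 21 elements. -/
/-- The submonoid generated by the fundamental weights and simple roots of `PSL₃` consists of all
lattice points of the cone spanned by the simple roots. -/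
theorem mem_closure_weights_roots_iff (x : ℤ × ℤ) :
    x ∈ AddSubmonoid.closure ({((1:ℤ),(0:ℤ)), (0,1), (2,-1), (-1,2)} : Set (ℤ × ℤ)) ↔
      0 ≤ x.1 + 2 * x.2 ∧ 0 ≤ 2 * x.1 + x.2 := by
  constructor
  · intro hx
    induction hx using AddSubmonoid.closure_induction with
    | mem y hy =>
      simp only [Set.mem_insert_iff, Set.mem_singleton_iff] at hy
      rcases hy with rfl | rfl | rfl | rfl <;> norm_num
    | zero => simp
    | add y z _ _ hy hz =>
      simp only [Prod.fst_add, Prod.snd_add]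
      omega
  · obtain ⟨a, b⟩ := x
    rintro ⟨h₁, h₂⟩
    simp only at h₁ h₂
    set S : Set (ℤ × ℤ) := {((1:ℤ),(0:ℤ)), (0,1), (2,-1), (-1,2)} with hS
    have combination_mem : ∀ (m n : ℤ) (v w : ℤ × ℤ), 0 ≤ m → 0 ≤ n → v ∈ S → w ∈ S →
        m • v + n • w = (a, b) → (a, b) ∈ AddSubmonoid.closure S := by
      intro m n v w hm hn hv hw h
      lift m to ℕ using hm
      lift n to ℕ using hn
      rw [natCast_zsmul, natCast_zsmul] at h
      rw [← h]
      exact add_mem (nsmul_mem (AddSubmonoid.subset_closure hv) m)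
        (nsmul_mem (AddSubmonoid.subset_closure hw) n)
    rcases lt_or_ge b 0 with hb | hb
    · exact combination_mem (-b) (a + 2 * b) (2, -1) (1, 0) (by omega) (by omega) (by simp [hS])
        (by simp [hS]) (by ext <;> simp; ring)
    rcases lt_or_ge a 0 with ha | ha
    · exact combination_mem (-a) (2 * a + b) (-1, 2) (0, 1) (by omega) (by omega) (by simp [hS])
        (by simp [hS]) (by ext <;> simp; ring)
    · exact combination_mem a b (1, 0) (0, 1) ha hb (by simp [hS]) (by simp [hS])
        (by ext <;> simp)

/-- The weights `μ` for which `μ.1 + 2 * μ.2` and `2 * μ.1 + μ.2` lie in the integer intervals of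
length `k` ending at `s` and `t`. -/
def weightParallelogram (k s t : ℤ) : Set (ℤ × ℤ) :=
  {μ | (s - k ≤ μ.1 + 2 * μ.2 ∧ μ.1 + 2 * μ.2 ≤ s) ∧
    (t - k ≤ 2 * μ.1 + μ.2 ∧ 2 * μ.1 + μ.2 ≤ t)}

/-- The points of `weightParallelogram k r 0`, for `k ≤ 8` and `0 ≤ r ≤ 2`, as a finset. -/
noncomputable def baseParallelogram (k r : ℤ) : Finset (ℤ × ℤ) :=
  (Finset.Icc (-6 : ℤ) 6 ×ˢ Finset.Icc (-6 : ℤ) 6).filter fun μ =>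
    (r - k ≤ μ.1 + 2 * μ.2 ∧ μ.1 + 2 * μ.2 ≤ r) ∧ (-k ≤ 2 * μ.1 + μ.2 ∧ 2 * μ.1 + μ.2 ≤ 0)

theorem exists_weightParallelogram_eq_image (s t : ℤ) :
    ∃ r : ℤ, (r = 0 ∨ r = 1 ∨ r = 2) ∧ ∃ c : ℤ × ℤ, ∀ k ≤ 8,
      weightParallelogram k s t = (c + ·) '' (baseParallelogram k r : Set (ℤ × ℤ)) := by
  refine ⟨(s - 2 * t) % 3, by omega, (-((s - 2 * t) / 3), t + 2 * ((s - 2 * t) / 3)), ?_⟩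
  intro k hk
  ext ⟨u, v⟩
  simp only [weightParallelogram, baseParallelogram, Set.mem_ofPred_eq, Set.mem_image,
    Finset.mem_coe, Finset.mem_filter, Finset.mem_product, Finset.mem_Icc, Prod.exists,
    Prod.mk_add_mk, Prod.mk.injEq]
  constructor
  · intro h
    exact ⟨u + (s - 2 * t) / 3, v - (t + 2 * ((s - 2 * t) / 3)), by omega, by omega, by omega⟩
  · rintro ⟨a, b, h, rfl, rfl⟩
    omega

theorem weightParallelogram_eight (s t : ℤ) :
    (weightParallelogram 8 s t).Finite ∧ (weightParallelogram 8 s t).ncard ≤ 27 := by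
  obtain ⟨r, hr, c, h⟩ := exists_weightParallelogram_eq_image s t
  rw [h 8 le_rfl]
  refine ⟨(Finset.finite_toSet _).image _, ?_⟩
  rw [Set.ncard_image_of_injective _ (add_right_injective c), Set.ncard_coe_finset]
  rcases hr with rfl | rfl | rfl <;> decide +kernel

theorem le_ncard_weightParallelogram_seven (s t : ℤ) :
    21 ≤ (weightParallelogram 7 s t).ncard := by
  obtain ⟨r, hr, c, h⟩ := exists_weightParallelogram_eq_image s t
  rw [h 7 (by norm_num), Set.ncard_image_of_injective _ (add_right_injective c),
    Set.ncard_coe_finset]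
  rcases hr with rfl | rfl | rfl <;> decide +kernel

theorem sub_eight_le_and_le_ediv {p l x : ℤ} (hp : 0 < p) (h₀ : 0 ≤ l - p * x)
    (h₁ : l - p * x ≤ 9 * (p - 1)) : l / p - 8 ≤ x ∧ x ≤ l / p := by
  constructor
  · have : l / p < x + 9 := Int.ediv_lt_of_lt_mul hp (by linarith)
    omega
  · exact (Int.le_ediv_iff_mul_le hp).2 (by linarith)

theorem sub_mul_mem_Icc_of_sub_seven_le {p l x : ℤ} (hp : 9 < p) (h₀ : l / p - 7 ≤ x)
    (h₁ : x ≤ l / p) : 0 ≤ l - p * x ∧ l - p * x ≤ 9 * (p - 1) := by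
  have h_low := (Int.le_ediv_iff_mul_le (by omega)).1 h₁
  have h_high := Int.lt_mul_ediv_self_add (x := l) (show 0 < p by omega)
  constructor <;> nlinarith

/-- For a prime `p > 3` and any `λ ∈ ℤ × ℤ`, the set of `μ` with
`λ - p•μ ∈ M` and `(3(p-1), 3(p-1)) - (λ - p•μ) ∈ M`, where `M` is the submonoid
generated by `(1,0), (0,1), (2,-1), (-1,2)`, is finite with at most 27 elements;
and if `p > 9` it has at least 21 elements. -/
theorem stmt2 (p : ℕ) (hp : p.Prime) (hp3 : 3 < p) (lam : ℤ × ℤ)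
    (M : AddSubmonoid (ℤ × ℤ))
    (hM : M = AddSubmonoid.closure ({((1:ℤ),(0:ℤ)), (0,1), (2,-1), (-1,2)} : Set (ℤ × ℤ)))
    (N : Set (ℤ × ℤ))
    (hN : N = {μ : ℤ × ℤ | lam - (p : ℤ) • μ ∈ M ∧
      ((3 * ((p : ℤ) - 1), 3 * ((p : ℤ) - 1)) - (lam - (p : ℤ) • μ)) ∈ M}) :
    N.Finite ∧ N.ncard ≤ 27 ∧ (9 < p → 21 ≤ N.ncard) := by
  have hp0 : (0 : ℤ) < p := by exact_mod_cast hp.pos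
  obtain ⟨a, b⟩ := lam
  have mem_N_iff (μ : ℤ × ℤ) : μ ∈ N ↔
      (0 ≤ a + 2 * b - p * (μ.1 + 2 * μ.2) ∧
        a + 2 * b - p * (μ.1 + 2 * μ.2) ≤ 9 * ((p : ℤ) - 1)) ∧
      (0 ≤ 2 * a + b - p * (2 * μ.1 + μ.2) ∧
        2 * a + b - p * (2 * μ.1 + μ.2) ≤ 9 * ((p : ℤ) - 1)) := by
    rw [hN, hM, Set.mem_ofPred_eq, mem_closure_weights_roots_iff, mem_closure_weights_roots_iff]
    simp only [Prod.fst_sub, Prod.snd_sub, Prod.smul_fst, Prod.smul_snd, smul_eq_mul]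
    constructor
    · rintro ⟨⟨h₁, h₂⟩, h₃, h₄⟩
      refine ⟨⟨?_, ?_⟩, ?_, ?_⟩ <;> linarith
    · rintro ⟨⟨h₁, h₂⟩, h₃, h₄⟩
      refine ⟨⟨?_, ?_⟩, ?_, ?_⟩ <;> linarith
  have N_subset : N ⊆ weightParallelogram 8 ((a + 2 * b) / p) ((2 * a + b) / p) := by
    intro μ hμ
    obtain ⟨⟨h₁, h₂⟩, h₃, h₄⟩ := (mem_N_iff μ).1 hμ
    exact ⟨sub_eight_le_and_le_ediv hp0 h₁ h₂, sub_eight_le_and_le_ediv hp0 h₃ h₄⟩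
  obtain ⟨h_fin, h_card⟩ := weightParallelogram_eight ((a + 2 * b) / p) ((2 * a + b) / p)
  have N_finite := h_fin.subset N_subset
  refine ⟨N_finite, (Set.ncard_le_ncard N_subset h_fin).trans h_card, fun hp9 => ?_⟩
  have hp9' : (9 : ℤ) < p := by exact_mod_cast hp9
  refine (le_ncard_weightParallelogram_seven ((a + 2 * b) / p) ((2 * a + b) / p)).trans
    (Set.ncard_le_ncard (fun μ hμ => (mem_N_iff μ).2 ?_) N_finite)
  obtain ⟨⟨h₁, h₂⟩, h₃, h₄⟩ := hμ
  exact ⟨sub_mul_mem_Icc_of_sub_seven_le hp9' h₁ h₂, sub_mul_mem_Icc_of_sub_seven_le hp9' h₃ h₄⟩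
end

section
/- For every natural number n, the set of pairs (x, y) ∈ ℤ × ℤ satisfying the four inequalities −x ≤ 2y, 2y ≤ 9n − x, −2x ≤ y, and y ≤ 9n − 2x is finite and has exactly 27n² + 6n + 1 elements. -/
/-- The map `(i, j) ↦ (2j - i, 2i - j)`, which parametrizes the sublattice of those `(x, y)` with
`x + 2y = 3i` and `2x + y = 3j`, translated by `c`. -/
def translatedSublattice (c : ℤ × ℤ) (p : ℤ × ℤ) : ℤ × ℤ :=
  (2 * p.2 - p.1 + c.1, 2 * p.1 - p.2 + c.2)

theorem translatedSublattice_injective (c : ℤ × ℤ) :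
    Function.Injective (translatedSublattice c) := by
  rintro ⟨i, j⟩ ⟨k, l⟩ h
  simp only [translatedSublattice, Prod.mk.injEq] at h ⊢
  omega

/-- The lattice points of the translated parallelogram with parameters `0 ≤ i, j < m`. -/
noncomputable def parallelogramPoints (c : ℤ × ℤ) (m : ℕ) : Finset (ℤ × ℤ) :=
  (Finset.Ico 0 (m : ℤ) ×ˢ Finset.Ico 0 (m : ℤ)).image (translatedSublattice c)

theorem card_parallelogramPoints (c : ℤ × ℤ) (m : ℕ) :
    (parallelogramPoints c m).card = m * m := by
  simp [parallelogramPoints, Finset.card_image_of_injective _ (translatedSublattice_injective c)]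

theorem mem_parallelogramPoints (c : ℤ × ℤ) (m : ℕ) (x y : ℤ) :
    (x, y) ∈ parallelogramPoints c m ↔
      ∃ i j : ℤ, (0 ≤ i ∧ i < m) ∧ (0 ≤ j ∧ j < m) ∧
        2 * j - i + c.1 = x ∧ 2 * i - j + c.2 = y := by
  simp [parallelogramPoints, translatedSublattice, and_assoc]

/-- For every natural number `n`, the set of `(x, y) ∈ ℤ × ℤ` with
`-x ≤ 2y`, `2y ≤ 9n - x`, `-2x ≤ y`, `y ≤ 9n - 2x` is finite and has exactly
`27n² + 6n + 1` elements. -/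
theorem stmt3 (n : ℕ)
    (S : Set (ℤ × ℤ))
    (hS : S = {v : ℤ × ℤ | -v.1 ≤ 2 * v.2 ∧ 2 * v.2 ≤ 9 * (n : ℤ) - v.1 ∧
      -(2 * v.1) ≤ v.2 ∧ v.2 ≤ 9 * (n : ℤ) - 2 * v.1}) :
    S.Finite ∧ S.ncard = 27 * n ^ 2 + 6 * n + 1 := by
  -- The three pieces are the points with `x + 2y` congruent to `0`, `1`, `2` modulo `3`.
  set A := parallelogramPoints (0, 0) (3 * n + 1) with hA
  set B := parallelogramPoints (1, 0) (3 * n) with hB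
  set C := parallelogramPoints (0, 1) (3 * n) with hC
  have hunion : S = ↑(A ∪ B ∪ C) := by
    ext ⟨x, y⟩
    simp only [hS, hA, hB, hC, Set.mem_ofPred_eq, Finset.mem_coe, Finset.mem_union,
      mem_parallelogramPoints]
    push_cast
    constructor
    · intro h
      have hmod : (x + 2 * y) % 3 = 0 ∨ (x + 2 * y) % 3 = 1 ∨ (x + 2 * y) % 3 = 2 := by omega
      rcases hmod with h0 | h1 | h2
      · exact Or.inl (Or.inl ⟨(x + 2 * y) / 3, (2 * x + y) / 3, by omega⟩)
      · exact Or.inl (Or.inr ⟨(x + 2 * y) / 3, (2 * x + y) / 3, by omega⟩)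
      · exact Or.inr ⟨(x + 2 * y) / 3, (2 * x + y) / 3, by omega⟩
    · rintro ((⟨i, j, h⟩ | ⟨i, j, h⟩) | ⟨i, j, h⟩) <;> omega
  have hAB : Disjoint A B := by
    rw [Finset.disjoint_left]
    rintro ⟨x, y⟩ h h'
    obtain ⟨i, j, h⟩ := (mem_parallelogramPoints _ _ _ _).1 h
    obtain ⟨k, l, h'⟩ := (mem_parallelogramPoints _ _ _ _).1 h'
    omega
  have hABC : Disjoint (A ∪ B) C := by
    rw [Finset.disjoint_left]
    rintro ⟨x, y⟩ h h'
    obtain ⟨k, l, h'⟩ := (mem_parallelogramPoints _ _ _ _).1 h'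
    rcases Finset.mem_union.1 h with h | h <;>
    · obtain ⟨i, j, h⟩ := (mem_parallelogramPoints _ _ _ _).1 h
      omega
  rw [hunion]
  refine ⟨Finset.finite_toSet _, ?_⟩
  rw [Set.ncard_coe_finset, Finset.card_union_of_disjoint hABC, Finset.card_union_of_disjoint hAB,
    hA, hB, hC]
  simp only [card_parallelogramPoints]
  ring
end

section
/- Let p be a prime with p > 9. For λ ∈ ℤ × ℤ, let B(λ) be the set of all μ ∈ ℤ × ℤ such that λ − p·μ = a₁·(1,0) + a₂·(0,1) + b₁·(2,−1) + b₂·(−1,2) for some integers a₁, a₂, b₁, b₂ with 0 ≤ a₁, a₂ ≤ 2(p−1) and 0 ≤ b₁, b₂ ≤ p−1. Then B(λ) is finite and 14 ≤ |B(λ)| ≤ 19 for every λ. -/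
/-- The lattice points of the octagon spanned by two copies of each fundamental weight and one copy
of each simple root of `PSL₃`, dilated by `n`. -/
def InOctagon (n x y : ℤ) : Prop :=
  (-n ≤ x ∧ x ≤ 4 * n) ∧ (-n ≤ y ∧ y ≤ 4 * n) ∧
    (0 ≤ x + 2 * y ∧ x + 2 * y ≤ 9 * n) ∧ (0 ≤ 2 * x + y ∧ 2 * x + y ≤ 9 * n)

instance (n x y : ℤ) : Decidable (InOctagon n x y) :=
  inferInstanceAs (Decidable (_ ∧ _))

/-- Every lattice point of the octagon is an integral combination of its edge vectors with
coefficients in the allowed ranges. -/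
lemma exists_coeffs_iff_inOctagon {n : ℤ} (hn : 0 < n) (x y : ℤ) :
    (∃ a₁ a₂ b₁ b₂ : ℤ, 0 ≤ a₁ ∧ a₁ ≤ 2 * n ∧ 0 ≤ a₂ ∧ a₂ ≤ 2 * n ∧
      0 ≤ b₁ ∧ b₁ ≤ n ∧ 0 ≤ b₂ ∧ b₂ ≤ n ∧
      x = a₁ + 2 * b₁ - b₂ ∧ y = a₂ - b₁ + 2 * b₂) ↔ InOctagon n x y := by
  unfold InOctagon
  constructor
  · rintro ⟨a₁, a₂, b₁, b₂, h⟩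
    omega
  · intro h
    suffices hb : ∃ b₁ b₂ : ℤ, (0 ≤ b₁ ∧ b₁ ≤ n) ∧ (0 ≤ b₂ ∧ b₂ ≤ n) ∧
        (0 ≤ x - 2 * b₁ + b₂ ∧ x - 2 * b₁ + b₂ ≤ 2 * n) ∧
        (0 ≤ y + b₁ - 2 * b₂ ∧ y + b₁ - 2 * b₂ ≤ 2 * n) by
      obtain ⟨b₁, b₂, hb⟩ := hb
      exact ⟨x - 2 * b₁ + b₂, y + b₁ - 2 * b₂, b₁, b₂, by omega⟩
    by_cases hx : 2 * (x - 2 * n) + (y - 2 * n) ≤ 0 ∧ x ≤ 2 * n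
    · by_cases hy : y < 0
      · exact ⟨max (-y) ((x - 2 * n + 1) / 2), 0, by omega⟩
      · exact ⟨0, max 0 (max (-x) ((y - 2 * n + 1) / 2)), by omega⟩
    by_cases hy : (x - 2 * n) + 2 * (y - 2 * n) ≤ 0
    · exact ⟨max 0 (max (-y) ((x - 2 * n + 1) / 2)), 0, by omega⟩
    exact ⟨(2 * (x - 2 * n) + (y - 2 * n) + 2) / 3,
      ((x - 2 * n) + 2 * (y - 2 * n) + 2) / 3, by omega⟩

/-- The pairs `(k, l)` for which `(r + p * k, s + p * l)` lies in the octagon of size `p - 1`. -/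
def octagonTranslates (p r s : ℤ) : Finset (ℤ × ℤ) :=
  (({-1, 0, 1, 2, 3} : Finset ℤ) ×ˢ ({-1, 0, 1, 2, 3} : Finset ℤ)).filter fun κ =>
    InOctagon (p - 1) (r + p * κ.1) (s + p * κ.2)

lemma mem_octagonTranslates {p r s : ℤ} (hr : 0 ≤ r) (hrp : r < p) (hs : 0 ≤ s) (hsp : s < p)
    (κ : ℤ × ℤ) :
    κ ∈ octagonTranslates p r s ↔ InOctagon (p - 1) (r + p * κ.1) (s + p * κ.2) := by
  have bound (t k : ℤ) (ht : 0 ≤ t) (htp : t < p) (h₁ : -(p - 1) ≤ t + p * k)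
      (h₂ : t + p * k ≤ 4 * (p - 1)) : k ∈ ({-1, 0, 1, 2, 3} : Finset ℤ) := by
    have hlo : -2 < k := by nlinarith
    have hhi : k < 4 := by nlinarith
    simp only [Finset.mem_insert, Finset.mem_singleton]
    omega
  simp only [octagonTranslates, Finset.mem_filter, Finset.mem_product, and_iff_right_iff_imp]
  exact fun h => ⟨bound r _ hr hrp h.1.1 h.1.2, bound s _ hs hsp h.2.1.1 h.2.1.2⟩

set_option maxHeartbeats 1000000 in
lemma card_octagonTranslates {p r s : ℤ} (hp : 9 < p) (hr : 0 ≤ r) (hrp : r < p)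
    (hs : 0 ≤ s) (hsp : s < p) :
    14 ≤ (octagonTranslates p r s).card ∧ (octagonTranslates p r s).card ≤ 19 := by
  have expand (f : ℤ → ℕ) :
      ∑ k ∈ ({-1, 0, 1, 2, 3} : Finset ℤ), f k = f (-1) + f 0 + f 1 + f 2 + f 3 := by
    simp [add_assoc]
  rw [octagonTranslates, Finset.card_filter, Finset.sum_product]
  simp only [expand]
  have hmm : ¬ InOctagon (p - 1) (r + p * -1) (s + p * -1) := by unfold InOctagon; omega
  have hm0 : InOctagon (p - 1) (r + p * -1) (s + p * 0) ↔
      1 ≤ r ∧ p ≤ r + 2 * s ∧ 2 * p ≤ 2 * r + s := by unfold InOctagon; omega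
  have hm1 : InOctagon (p - 1) (r + p * -1) (s + p * 1) ↔ 1 ≤ r ∧ p ≤ 2 * r + s := by
    unfold InOctagon; omega
  have hm2 : InOctagon (p - 1) (r + p * -1) (s + p * 2) ↔ 1 ≤ r := by unfold InOctagon; omega
  have hm3 : InOctagon (p - 1) (r + p * -1) (s + p * 3) ↔ 1 ≤ r ∧ s ≤ p - 4 := by
    unfold InOctagon; omega
  have h0m : InOctagon (p - 1) (r + p * 0) (s + p * -1) ↔
      1 ≤ s ∧ 2 * p ≤ r + 2 * s ∧ p ≤ 2 * r + s := by unfold InOctagon; omega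
  have h1m : InOctagon (p - 1) (r + p * 1) (s + p * -1) ↔ 1 ≤ s ∧ p ≤ r + 2 * s := by
    unfold InOctagon; omega
  have h2m : InOctagon (p - 1) (r + p * 2) (s + p * -1) ↔ 1 ≤ s := by unfold InOctagon; omega
  have h3m : InOctagon (p - 1) (r + p * 3) (s + p * -1) ↔ 1 ≤ s ∧ r ≤ p - 4 := by
    unfold InOctagon; omega
  have h00 : InOctagon (p - 1) (r + p * 0) (s + p * 0) := by unfold InOctagon; omega
  have h01 : InOctagon (p - 1) (r + p * 0) (s + p * 1) := by unfold InOctagon; omega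
  have h02 : InOctagon (p - 1) (r + p * 0) (s + p * 2) := by unfold InOctagon; omega
  have h10 : InOctagon (p - 1) (r + p * 1) (s + p * 0) := by unfold InOctagon; omega
  have h11 : InOctagon (p - 1) (r + p * 1) (s + p * 1) := by unfold InOctagon; omega
  have h12 : InOctagon (p - 1) (r + p * 1) (s + p * 2) := by unfold InOctagon; omega
  have h20 : InOctagon (p - 1) (r + p * 2) (s + p * 0) := by unfold InOctagon; omega
  have h21 : InOctagon (p - 1) (r + p * 2) (s + p * 1) := by unfold InOctagon; omega
  have h22 : InOctagon (p - 1) (r + p * 2) (s + p * 2) ↔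
      r + 2 * s ≤ 3 * p - 9 ∧ 2 * r + s ≤ 3 * p - 9 := by unfold InOctagon; omega
  have h30 : InOctagon (p - 1) (r + p * 3) (s + p * 0) ↔
      r ≤ p - 4 ∧ 2 * r + s ≤ 3 * p - 9 := by unfold InOctagon; omega
  have h31 : InOctagon (p - 1) (r + p * 3) (s + p * 1) ↔
      r ≤ p - 4 ∧ 2 * r + s ≤ 2 * p - 9 := by unfold InOctagon; omega
  have h32 : InOctagon (p - 1) (r + p * 3) (s + p * 2) ↔
      r ≤ p - 4 ∧ r + 2 * s ≤ 2 * p - 9 ∧ 2 * r + s ≤ p - 9 := by unfold InOctagon; omega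
  have h03 : InOctagon (p - 1) (r + p * 0) (s + p * 3) ↔
      s ≤ p - 4 ∧ r + 2 * s ≤ 3 * p - 9 := by unfold InOctagon; omega
  have h13 : InOctagon (p - 1) (r + p * 1) (s + p * 3) ↔
      s ≤ p - 4 ∧ r + 2 * s ≤ 2 * p - 9 := by unfold InOctagon; omega
  have h23 : InOctagon (p - 1) (r + p * 2) (s + p * 3) ↔
      s ≤ p - 4 ∧ r + 2 * s ≤ p - 9 ∧ 2 * r + s ≤ 2 * p - 9 := by unfold InOctagon; omega
  have h33 : ¬ InOctagon (p - 1) (r + p * 3) (s + p * 3) := by unfold InOctagon; omega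
  simp only [hmm, hm0, hm1, hm2, hm3, h0m, h1m, h2m, h3m, h00, h01, h02, h10, h11, h12, h20, h21,
    h22, h30, h31, h32, h03, h13, h23, h33, if_true, if_false]
  clear hmm hm0 hm1 hm2 hm3 h0m h1m h2m h3m h00 h01 h02 h10 h11 h12 h20 h21 h22 h30 h31 h32 h03
    h13 h23 h33 expand
  have regions (w : ℤ) : w ≤ p - 9 ∨ (p - 9 < w ∧ w < p) ∨ (p ≤ w ∧ w ≤ 2 * p - 9) ∨
      (2 * p - 9 < w ∧ w < 2 * p) ∨ (2 * p ≤ w ∧ w ≤ 3 * p - 9) ∨ 3 * p - 9 < w := by omega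
  have sides (t : ℤ) : t < 1 ∨ (1 ≤ t ∧ t ≤ p - 4) ∨ p - 4 < t := by omega
  rcases regions (r + 2 * s) with hu | hu | hu | hu | hu | hu <;>
  rcases regions (2 * r + s) with hv | hv | hv | hv | hv | hv <;>
  rcases sides r with h₁ | h₁ | h₁ <;>
  rcases sides s with h₂ | h₂ | h₂ <;>
  first
  | (exfalso; omega)
  | (simp (disch := omega) only [if_pos, if_neg]; omega)

/-- For a prime `p > 9` and any `λ ∈ ℤ × ℤ`, the set of `μ` such that
`λ - p•μ = a₁•(1,0) + a₂•(0,1) + b₁•(2,-1) + b₂•(-1,2)` for some integers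
`0 ≤ a₁, a₂ ≤ 2(p-1)` and `0 ≤ b₁, b₂ ≤ p-1` is finite and has between 14 and 19
elements. -/
theorem stmt4 (p : ℕ) (hp : p.Prime) (hp9 : 9 < p) (lam : ℤ × ℤ)
    (B : Set (ℤ × ℤ))
    (hB : B = {μ : ℤ × ℤ | ∃ a₁ a₂ b₁ b₂ : ℤ,
      0 ≤ a₁ ∧ a₁ ≤ 2 * ((p : ℤ) - 1) ∧ 0 ≤ a₂ ∧ a₂ ≤ 2 * ((p : ℤ) - 1) ∧
      0 ≤ b₁ ∧ b₁ ≤ (p : ℤ) - 1 ∧ 0 ≤ b₂ ∧ b₂ ≤ (p : ℤ) - 1 ∧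
      lam - (p : ℤ) • μ =
        a₁ • (((1:ℤ),(0:ℤ)) : ℤ × ℤ) + a₂ • (((0:ℤ),(1:ℤ)) : ℤ × ℤ) +
        b₁ • (((2:ℤ),(-1:ℤ)) : ℤ × ℤ) + b₂ • (((-1:ℤ),(2:ℤ)) : ℤ × ℤ)}) :
    B.Finite ∧ 14 ≤ B.ncard ∧ B.ncard ≤ 19 := by
  obtain ⟨x, y⟩ := lam
  have hp0 : (0 : ℤ) < p := by omega
  have hr := Int.emod_nonneg x hp0.ne'
  have hrp := Int.emod_lt_of_pos x hp0
  have hs := Int.emod_nonneg y hp0.ne'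
  have hsp := Int.emod_lt_of_pos y hp0
  have hcard := card_octagonTranslates (p := p) (by omega) hr hrp hs hsp
  have hBeq : B = Equiv.subLeft (x / (p : ℤ), y / (p : ℤ)) ''
      (octagonTranslates p (x % p) (y % p) : Set (ℤ × ℤ)) := by
    ext ⟨k, l⟩
    rw [Equiv.image_eq_preimage_symm, Set.mem_preimage, Finset.mem_coe,
      mem_octagonTranslates hr hrp hs hsp, hB, ← exists_coeffs_iff_inOctagon (by omega)]
    have hx : x % (p : ℤ) + p * (x / p - k) = x - p * k := by
      linear_combination Int.emod_add_mul_ediv x p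
    have hy : y % (p : ℤ) + p * (y / p - l) = y - p * l := by
      linear_combination Int.emod_add_mul_ediv y p
    have hsymm : (Equiv.subLeft (x / (p : ℤ), y / (p : ℤ))).symm (k, l) =
        (x / (p : ℤ) - k, y / (p : ℤ) - l) := by
      ext <;> simp [sub_eq_add_neg, add_comm]
    simp only [hsymm, hx, hy, Set.mem_ofPred_eq, Prod.ext_iff, Prod.fst_sub, Prod.snd_sub,
      Prod.fst_add, Prod.snd_add, Prod.smul_fst, Prod.smul_snd, smul_eq_mul]
    exact exists₄_congr fun a₁ a₂ b₁ b₂ => by omega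
  rw [hBeq, Set.ncard_image_of_injective _ (Equiv.injective _), Set.ncard_coe_finset]
  exact ⟨(Finset.finite_toSet _).image _, hcard⟩
end
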